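/- (Lemma 2: turnpike near the steady-state.) Let Assumptions 1–4 hold, let (x_s,u_s)∈Z be a steady-state (f(x_s,u_s)=x_s, h_s:=h(x_s,u_s)≤0 componentwise), and assume the value function infimum is attained by a unique minimizer for every horizon and every initial condition in X×𝕳. Then there exist N_η∈ℕ and a function η:ℕ×[0,∞)→[0,∞) with the property that for every ε>0 there exist N₀∈ℕ and r₀>0 such that η(N,r)≤ε whenever N≥N₀ and r≤r₀, such that for any x∈B_{δ_c}(x_s), any H∈𝕳 with ⟨H−H^s⟩≤E_h and any horizon N≥N_η, the optimal trajectory u*:=u*_{N,x,H} satisfies ‖(x_{u*}(k,x)−x_s, u*(k)−u_s)‖ ≤ η(N, ‖x−x_s‖+⟨H−H^s⟩) for all integers k with 0 ≤ k ≤ N/2+T−1. -/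

import Mathlib

open Finset Filter
open scoped Classical

noncomputable section

namespace EMPC

abbrev Vec (n : ℕ) : Type := EuclideanSpace ℝ (Fin n)

variable {n m p : ℕ}

/-- Trajectory of the discrete-time system `x(k+1) = f(x(k), u(k))`. -/
def traj (f : Vec n → Vec m → Vec n) (x : Vec n) (u : ℕ → Vec m) : ℕ → Vec n
  | 0 => x
  | k + 1 => f (traj f x u k) (u k)

/-- Open-loop cost `J_N(x,u)`. -/
def cost (f : Vec n → Vec m → Vec n) (ℓ : Vec n → Vec m → ℝ) (x : Vec n)
    (u : ℕ → Vec m) (N : ℕ) : ℝ :=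
  ∑ k ∈ Finset.range N, ℓ (traj f x u k) (u k)

/-- Admissibility `u ∈ U^N(x,H)` for the transient average constrained problem. -/
def Admissible (f : Vec n → Vec m → Vec n) (h : Vec n → Vec m → Vec p)
    (Z : Set (Vec n × Vec m)) (T N : ℕ) (x : Vec n) (H : ℕ → Vec p)
    (u : ℕ → Vec m) : Prop :=
  (∀ k < N, (traj f x u k, u k) ∈ Z) ∧
  (∀ j ∈ Finset.Icc 1 (T - 1), ∀ i : Fin p,
    (∑ l ∈ Finset.Icc j (T - 1), H l i)
      + ∑ k ∈ Finset.range j, h (traj f x u k) (u k) i ≤ 0) ∧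
  (∀ s : ℕ, s + T ≤ N → ∀ i : Fin p,
    ∑ k ∈ Finset.Ico s (s + T), h (traj f x u k) (u k) i ≤ 0)

/-- Class `K∞` comparison functions. -/
def KInf (α : ℝ → ℝ) : Prop :=
  ContinuousOn α (Set.Ici 0) ∧ StrictMonoOn α (Set.Ici 0) ∧ α 0 = 0 ∧
    Tendsto α atTop atTop

/-- Class `L_ℕ`: decreasing functions on ℕ with limit 0. -/
def LN (δ : ℕ → ℝ) : Prop :=
  Antitone δ ∧ (∀ k, 0 ≤ δ k) ∧ Tendsto δ atTop (nhds 0)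

/-- Class `KLS`. -/
def KLS (β : ℝ → ℕ → ℝ) : Prop :=
  (∀ k : ℕ, ContinuousOn (fun r => β r k) (Set.Ici 0) ∧
    StrictMonoOn (fun r => β r k) (Set.Ici 0) ∧ β 0 k = 0) ∧
  (∀ r : ℝ, 0 ≤ r → LN (fun k => β r k)) ∧
  (∀ r : ℝ, 0 ≤ r → Summable (fun k => β r k)) ∧
  (ContinuousOn (fun r => ∑' k, β r k) (Set.Ici 0) ∧
    StrictMonoOn (fun r => ∑' k, β r k) (Set.Ici 0) ∧ (∑' k, β 0 k) = 0)

/-- Class `KL`. -/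
def KLcl (β : ℝ → ℝ → ℝ) : Prop :=
  ContinuousOn (fun q : ℝ × ℝ => β q.1 q.2) (Set.Ici 0 ×ˢ Set.Ici 0) ∧
  (∀ s : ℝ, 0 ≤ s → StrictMonoOn (fun r => β r s) (Set.Ici 0) ∧ β 0 s = 0) ∧
  (∀ r : ℝ, 0 ≤ r → AntitoneOn (fun s => β r s) (Set.Ici 0) ∧
    Tendsto (fun s => β r s) atTop (nhds 0)) ∧
  (∀ r s : ℝ, 0 ≤ r → 0 ≤ s → 0 ≤ β r s)

/-- ℓ¹-norm of a vector. -/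
def l1 (v : Vec p) : ℝ := ∑ i, |v i|

/-- `Ĥ_k = Σ_i max{H_{ik}, 0}`. -/
def hatCol (H : ℕ → Vec p) (k : ℕ) : ℝ := ∑ i, max (H k i) 0

/-- Norm-like measure `⟨H⟩ = max_{k ∈ {1,…,T-1}} Ĥ_k`. -/
def measH (T : ℕ) (H : ℕ → Vec p) : ℝ := ⨆ k ∈ Finset.Icc 1 (T - 1), hatCol H k

/-- `‖H‖₁ = max_{k ∈ {1,…,T-1}} ‖H_k‖₁`. -/
def norm1H (T : ℕ) (H : ℕ → Vec p) : ℝ := ⨆ k ∈ Finset.Icc 1 (T - 1), l1 (H k)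

/-- The set `𝕳` of feasible stored outputs. -/
def HSet (h : Vec n → Vec m → Vec p) (Z : Set (Vec n × Vec m)) (T : ℕ) :
    Set (ℕ → Vec p) :=
  {H | ∀ k ∈ Finset.Icc 1 (T - 1), ∀ i : Fin p,
    sInf ((fun z : Vec n × Vec m => h z.1 z.2 i) '' Z) ≤ H k i ∧
    H k i ≤ sSup ((fun z : Vec n × Vec m => h z.1 z.2 i) '' Z)}

/-- Value function `J*_N(x,H)`. -/
def Jstar (f : Vec n → Vec m → Vec n) (ℓ : Vec n → Vec m → ℝ)
    (h : Vec n → Vec m → Vec p) (Z : Set (Vec n × Vec m)) (T N : ℕ)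
    (x : Vec n) (H : ℕ → Vec p) : ℝ :=
  sInf ((fun u => cost f ℓ x u N) '' {u | Admissible f h Z T N x H u})

/-- Rotated stage cost `ℓ̃`. -/
def rot (f : Vec n → Vec m → Vec n) (ℓ : Vec n → Vec m → ℝ)
    (h : Vec n → Vec m → Vec p) (ℓs : ℝ) (lam : Vec n → ℝ) (lb : Vec p)
    (x : Vec n) (u : Vec m) : ℝ :=
  ℓ x u - ℓs + lam x - lam (f x u) + ∑ i, lb i * h x u i

/-- Rotated open-loop cost. -/
def rcost (f : Vec n → Vec m → Vec n) (ℓ : Vec n → Vec m → ℝ)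
    (h : Vec n → Vec m → Vec p) (ℓs : ℝ) (lam : Vec n → ℝ) (lb : Vec p)
    (x : Vec n) (u : ℕ → Vec m) (N : ℕ) : ℝ :=
  ∑ k ∈ Finset.range N, rot f ℓ h ℓs lam lb (traj f x u k) (u k)

/-- Rotated value function `J̃*_N(x,H)`. -/
def Jtstar (f : Vec n → Vec m → Vec n) (ℓ : Vec n → Vec m → ℝ)
    (h : Vec n → Vec m → Vec p) (Z : Set (Vec n × Vec m)) (T : ℕ)
    (ℓs : ℝ) (lam : Vec n → ℝ) (lb : Vec p) (N : ℕ)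
    (x : Vec n) (H : ℕ → Vec p) : ℝ :=
  sInf ((fun u => rcost f ℓ h ℓs lam lb x u N) '' {u | Admissible f h Z T N x H u})

/-- `k_{T,N} = ⌈N/T⌉·T − N`. -/
def kTN (T N : ℕ) : ℕ := ((N + T - 1) / T) * T - N

/-- The stored-output matrix along a trajectory, starting at time `d`
(column `k ∈ {1,…,T-1}` is the auxiliary output at time `d + k - 1`). -/
def storedH (f : Vec n → Vec m → Vec n) (h : Vec n → Vec m → Vec p)
    (x : Vec n) (u : ℕ → Vec m) (d : ℕ) : ℕ → Vec p :=
  fun k => h (traj f x u (d + k - 1)) (u (d + k - 1))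

/-- Local controllability (Assumption 4). -/
def LocCtrl (f : Vec n → Vec m → Vec n) (h : Vec n → Vec m → Vec p)
    (Z : Set (Vec n × Vec m)) (T : ℕ) (xs : Vec n) (δc Eh : ℝ) (d : ℕ)
    (γx γu : ℝ → ℝ) : Prop :=
  ∀ (xc : Vec n) (Hc : ℕ → Vec p) (uc : ℕ → Vec m),
    Admissible f h Z T (d + T) xc Hc uc →
    measH T Hc ≤ Eh →
    (∀ k ≤ d + T, ‖traj f xc uc k - xs‖ ≤ δc) →
    ∀ (N₁ : ℕ) (x₁ : Vec n) (H₁ : ℕ → Vec p) (u₁ : ℕ → Vec m),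
      d + T ≤ N₁ → x₁ ∈ Prod.fst '' Z → H₁ ∈ HSet h Z T →
      Admissible f h Z T N₁ x₁ H₁ u₁ →
      measH T (fun k => storedH f h x₁ u₁ d k - storedH f h xc uc d k) ≤ Eh →
      ‖traj f x₁ u₁ d - xs‖ ≤ δc →
      ∀ (x₂ : Vec n) (H₂ : ℕ → Vec p),
        ‖x₂ - xs‖ ≤ δc → measH T (fun k => H₂ k - Hc k) ≤ Eh →
        ∃ u₂ : ℕ → Vec m,
          Admissible f h Z T d x₂ H₂ u₂ ∧
          traj f x₂ u₂ d = traj f x₁ u₁ d ∧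
          Admissible f h Z T N₁ x₂ H₂ (fun k => if k < d then u₂ k else u₁ k) ∧
          ∀ k ≤ d,
            ‖traj f x₂ u₂ k - traj f xc uc k‖ ≤
              γx (max (‖x₂ - xc‖ + measH T (fun j => H₂ j - Hc j))
                (‖traj f x₁ u₁ d - traj f xc uc d‖ +
                  measH T (fun j => storedH f h x₁ u₁ d j - storedH f h xc uc d j))) ∧
            ‖u₂ k - uc k‖ ≤
              γu (max (‖x₂ - xc‖ + measH T (fun j => H₂ j - Hc j))
                (‖traj f x₁ u₁ d - traj f xc uc d‖ +
                  measH T (fun j => storedH f h x₁ u₁ d j - storedH f h xc uc d j)))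

/-- Shift dynamics of the stored outputs: `f_H(H, y) = [H_2, …, H_{T-1}, y]`. -/
def shiftH (T : ℕ) (H : ℕ → Vec p) (y : Vec p) : ℕ → Vec p :=
  fun k => if k + 1 < T then H (k + 1) else if k + 1 = T then y else H k

/-- Closed-loop trajectory of the extended state `χ = (x, H)` under the MPC
feedback `μ_N(x,H) = u*_{N,x,H}(0)`. -/
def clTraj (f : Vec n → Vec m → Vec n) (h : Vec n → Vec m → Vec p)
    (ustar : ℕ → Vec n → (ℕ → Vec p) → ℕ → Vec m) (N T : ℕ)
    (χ : Vec n × (ℕ → Vec p)) : ℕ → Vec n × (ℕ → Vec p)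
  | 0 => χ
  | k + 1 =>
    (f (clTraj f h ustar N T χ k).1
        (ustar N (clTraj f h ustar N T χ k).1 (clTraj f h ustar N T χ k).2 0),
      shiftH T (clTraj f h ustar N T χ k).2
        (h (clTraj f h ustar N T χ k).1
          (ustar N (clTraj f h ustar N T χ k).1 (clTraj f h ustar N T χ k).2 0)))

theorem traj_congr (f : Vec n → Vec m → Vec n) (x : Vec n) (u v : ℕ → Vec m) (j : ℕ)
    (huv : ∀ k < j, u k = v k) : traj f x u j = traj f x v j := by
  induction j with
  | zero => rfl
  | succ j ih =>
    simp only [traj]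
    rw [ih (fun k hk => huv k (by omega)), huv j (by omega)]

theorem traj_add (f : Vec n → Vec m → Vec n) (x : Vec n) (u : ℕ → Vec m) (P k : ℕ) :
    traj f x u (P + k) = traj f (traj f x u P) (fun k => u (P + k)) k := by
  induction k with
  | zero => rfl
  | succ k ih =>
    rw [← add_assoc]
    simp only [traj]
    rw [ih]

theorem traj_const (f : Vec n → Vec m → Vec n) (xs : Vec n) (us : Vec m)
    (hfix : f xs us = xs) (k : ℕ) : traj f xs (fun _ => us) k = xs := by
  induction k with
  | zero => rfl
  | succ k ih => simp only [traj]; rw [ih, hfix]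

theorem cost_add (f : Vec n → Vec m → Vec n) (ℓ : Vec n → Vec m → ℝ) (x : Vec n)
    (u : ℕ → Vec m) (P k : ℕ) :
    cost f ℓ x u (P + k) =
      cost f ℓ x u P + cost f ℓ (traj f x u P) (fun k => u (P + k)) k := by
  unfold cost
  rw [Finset.sum_range_add]
  congr 1
  refine Finset.sum_congr rfl fun j _ => ?_
  rw [traj_add]

theorem hatCol_nonneg (H : ℕ → Vec p) (k : ℕ) : 0 ≤ hatCol H k :=
  Finset.sum_nonneg fun _ _ => le_max_right _ _

theorem measH_nonneg (T : ℕ) (H : ℕ → Vec p) : 0 ≤ measH T H :=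
  Real.iSup_nonneg fun k => Real.iSup_nonneg fun _ => hatCol_nonneg H k

theorem measH_le (T : ℕ) (H : ℕ → Vec p) (c : ℝ) (hc : 0 ≤ c)
    (hH : ∀ k ∈ Finset.Icc 1 (T - 1), hatCol H k ≤ c) : measH T H ≤ c :=
  Real.iSup_le (fun k => Real.iSup_le (fun hk => hH k hk) hc) hc

theorem measH_zero (T : ℕ) (H : ℕ → Vec p)
    (hH : ∀ k ∈ Finset.Icc 1 (T - 1), H k = 0) : measH T H = 0 := by
  refine le_antisymm (measH_le _ _ _ le_rfl fun k hk => ?_) (measH_nonneg _ _)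
  simp [hatCol, hH k hk]

theorem adm_const (f : Vec n → Vec m → Vec n) (h : Vec n → Vec m → Vec p)
    (Z : Set (Vec n × Vec m)) (T N : ℕ) (xs : Vec n) (us : Vec m)
    (hzs : (xs, us) ∈ Z) (hfix : f xs us = xs) (hhs : ∀ i, h xs us i ≤ 0) :
    Admissible f h Z T N xs (fun _ => h xs us) (fun _ => us) := by
  refine ⟨fun k _ => ?_, fun j _ i => ?_, fun s _ i => ?_⟩
  · rw [traj_const f xs us hfix]; exact hzs
  · simp only [traj_const f xs us hfix]
    exact add_nonpos (Finset.sum_nonpos fun _ _ => hhs i) (Finset.sum_nonpos fun _ _ => hhs i)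
  · simp only [traj_const f xs us hfix]
    exact Finset.sum_nonpos fun _ _ => hhs i

theorem adm_shift (f : Vec n → Vec m → Vec n) (h : Vec n → Vec m → Vec p)
    (Z : Set (Vec n × Vec m)) (T P N : ℕ) (x : Vec n) (H : ℕ → Vec p) (u : ℕ → Vec m)
    (hTP : T ≤ P) (hTN : T ≤ N) (hu : Admissible f h Z T (P + N) x H u) :
    Admissible f h Z T N (traj f x u P) (storedH f h x u (P - T + 1))
      (fun k => u (P + k)) := by
  obtain ⟨h1, h2, h3⟩ := hu
  refine ⟨fun k hk => ?_, fun j hj i => ?_, fun s hs i => ?_⟩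
  · rw [← traj_add]; exact h1 _ (by omega)
  · simp only [← traj_add]
    rw [Finset.mem_Icc] at hj
    have key := h3 (P - T + j) (by omega) i
    have e : P - T + j + T = P + j := by omega
    rw [e, ← Finset.sum_Ico_consecutive _ (show P - T + j ≤ P by omega)
      (show P ≤ P + j by omega)] at key
    have e1 : ∑ l ∈ Finset.Icc j (T - 1), storedH f h x u (P - T + 1) l i
        = ∑ k ∈ Finset.Ico (P - T + j) P, h (traj f x u k) (u k) i := by
      refine Finset.sum_bij (fun l _ => P - T + l) ?_ ?_ ?_ ?_
      · intro a ha; simp only [Finset.mem_Icc, Finset.mem_Ico] at *; omega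
      · intro a _ b _ hab; omega
      · intro b hb; simp only [Finset.mem_Icc, Finset.mem_Ico] at *
        exact ⟨b - (P - T), by omega, by omega⟩
      · intro a _
        have : P - T + 1 + a - 1 = P - T + a := by omega
        simp only [storedH, this]
    have e2 : ∑ k ∈ Finset.Ico P (P + j), h (traj f x u k) (u k) i
        = ∑ k ∈ Finset.range j, h (traj f x u (P + k)) (u (P + k)) i := by
      rw [Finset.sum_Ico_eq_sum_range]; simp
    rw [e1, ← e2]; exact key
  · simp only [← traj_add]
    have key := h3 (P + s) (by omega) i
    rw [Finset.sum_Ico_eq_sum_range] at key ⊢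
    have e : P + s + T - (P + s) = s + T - s := by omega
    rw [e] at key
    simpa only [add_assoc] using key

/-- Prepend `P` steps of steady-state operation. -/
def prep (us : Vec m) (P : ℕ) (u : ℕ → Vec m) : ℕ → Vec m :=
  fun k => if k < P then us else u (k - P)

theorem traj_prep_le (f : Vec n → Vec m → Vec n) (xs : Vec n) (us : Vec m)
    (hfix : f xs us = xs) (P : ℕ) (u : ℕ → Vec m) (k : ℕ) (hk : k ≤ P) :
    traj f xs (prep us P u) k = xs := by
  rw [traj_congr f xs _ (fun _ => us) k, traj_const f xs us hfix]
  intro j hj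
  simp [prep, show j < P by omega]

theorem prep_lt (us : Vec m) (P : ℕ) (u : ℕ → Vec m) (k : ℕ) (hk : k < P) :
    prep us P u k = us := by simp [prep, hk]

theorem prep_add (us : Vec m) (P : ℕ) (u : ℕ → Vec m) (k : ℕ) :
    prep us P u (P + k) = u k := by simp [prep]

theorem traj_prep_add (f : Vec n → Vec m → Vec n) (xs : Vec n) (us : Vec m)
    (hfix : f xs us = xs) (P : ℕ) (u : ℕ → Vec m) (k : ℕ) :
    traj f xs (prep us P u) (P + k) = traj f xs u k := by
  rw [traj_add, traj_prep_le f xs us hfix P u P le_rfl]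
  simp only [prep_add]

theorem adm_prep (f : Vec n → Vec m → Vec n) (h : Vec n → Vec m → Vec p)
    (Z : Set (Vec n × Vec m)) (T P N : ℕ) (xs : Vec n) (us : Vec m)
    (hzs : (xs, us) ∈ Z) (hfix : f xs us = xs) (hhs : ∀ i, h xs us i ≤ 0)
    (u : ℕ → Vec m) (hTP : T ≤ P)
    (hu : Admissible f h Z T N xs (fun _ => h xs us) u) :
    Admissible f h Z T (P + N) xs (fun _ => h xs us) (prep us P u) := by
  obtain ⟨h1, h2, h3⟩ := hu
  have hlt : ∀ k < P, h (traj f xs (prep us P u) k) (prep us P u k) = h xs us := by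
    intro k hk
    rw [traj_prep_le f xs us hfix P u k hk.le, prep_lt us P u k hk]
  refine ⟨fun k hk => ?_, fun j hj i => ?_, fun s hs i => ?_⟩
  · by_cases hkP : k < P
    · rw [traj_prep_le f xs us hfix P u k hkP.le, prep_lt us P u k hkP]; exact hzs
    · obtain ⟨j, rfl⟩ := Nat.exists_eq_add_of_le (not_lt.mp hkP)
      rw [traj_prep_add f xs us hfix, prep_add]; exact h1 _ (by omega)
  · rw [Finset.mem_Icc] at hj
    refine add_nonpos (Finset.sum_nonpos fun _ _ => hhs i) (Finset.sum_nonpos fun k hk => ?_)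
    rw [Finset.mem_range] at hk
    rw [hlt k (by omega)]; exact hhs i
  · by_cases hA : s + T ≤ P
    · refine Finset.sum_nonpos fun k hk => ?_
      rw [Finset.mem_Ico] at hk
      rw [hlt k (by omega)]; exact hhs i
    by_cases hB : P ≤ s
    · obtain ⟨t, rfl⟩ := Nat.exists_eq_add_of_le hB
      have key := h3 t (by omega) i
      rw [Finset.sum_Ico_eq_sum_range] at key ⊢
      have e : P + t + T - (P + t) = t + T - t := by omega
      rw [e]
      simp only [add_assoc, traj_prep_add f xs us hfix, prep_add]
      exact key
    · have key := h2 (s + T - P) (by rw [Finset.mem_Icc]; omega) i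
      rw [← Finset.sum_Ico_consecutive _ (show s ≤ P by omega) (show P ≤ s + T by omega)]
      have e1 : ∑ k ∈ Finset.Ico s P, h (traj f xs (prep us P u) k) (prep us P u k) i
          = ∑ l ∈ Finset.Icc (s + T - P) (T - 1), h xs us i := by
        rw [Finset.sum_congr rfl (g := fun _ => h xs us i)]
        · simp only [Finset.sum_const, Nat.card_Ico, Nat.card_Icc]
          congr 1; omega
        · intro k hk
          rw [Finset.mem_Ico] at hk
          rw [hlt k (by omega)]
      have e2 : ∑ k ∈ Finset.Ico P (s + T), h (traj f xs (prep us P u) k) (prep us P u k) i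
          = ∑ k ∈ Finset.range (s + T - P), h (traj f xs u k) (u k) i := by
        rw [Finset.sum_Ico_eq_sum_range]
        simp only [traj_prep_add f xs us hfix, prep_add]
      rw [e1, e2]; exact key

theorem cost_prep (f : Vec n → Vec m → Vec n) (ℓ : Vec n → Vec m → ℝ) (xs : Vec n)
    (us : Vec m) (hfix : f xs us = xs) (P : ℕ) (u : ℕ → Vec m) (k : ℕ) :
    cost f ℓ xs (prep us P u) (P + k) = P * ℓ xs us + cost f ℓ xs u k := by
  rw [cost_add, traj_prep_le f xs us hfix P u P le_rfl]
  simp only [prep_add]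
  congr 1
  unfold cost
  rw [Finset.sum_congr rfl (g := fun _ => ℓ xs us)]
  · simp
  · intro j hj
    rw [Finset.mem_range] at hj
    rw [traj_prep_le f xs us hfix P u j hj.le, prep_lt us P u j hj]

theorem cost_prep_le (f : Vec n → Vec m → Vec n) (ℓ : Vec n → Vec m → ℝ) (xs : Vec n)
    (us : Vec m) (hfix : f xs us = xs) (P : ℕ) (u : ℕ → Vec m) (k : ℕ) (hk : k ≤ P) :
    cost f ℓ xs (prep us P u) k = k * ℓ xs us := by
  unfold cost
  rw [Finset.sum_congr rfl (g := fun _ => ℓ xs us)]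
  · simp
  · intro j hj
    rw [Finset.mem_range] at hj
    rw [traj_prep_le f xs us hfix P u j (by omega), prep_lt us P u j (by omega)]

theorem cost_const (f : Vec n → Vec m → Vec n) (ℓ : Vec n → Vec m → ℝ) (xs : Vec n)
    (us : Vec m) (hfix : f xs us = xs) (k : ℕ) :
    cost f ℓ xs (fun _ => us) k = k * ℓ xs us := by
  unfold cost
  simp [traj_const f xs us hfix]

/-- Local controllability around the steady state: replace the first `d` steps. -/
theorem splice (T : ℕ) (f : Vec n → Vec m → Vec n) (ℓ : Vec n → Vec m → ℝ)
    (h : Vec n → Vec m → Vec p) (Z : Set (Vec n × Vec m)) (xs : Vec n) (us : Vec m)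
    (δc Eh : ℝ) (d : ℕ) (γx γu : ℝ → ℝ)
    (hzs : (xs, us) ∈ Z) (hfix : f xs us = xs) (hhs : ∀ i, h xs us i ≤ 0)
    (hδc : 0 < δc) (hEh : 0 < Eh) (hγx : KInf γx) (hγu : KInf γu)
    (hloc : LocCtrl f h Z T xs δc Eh d γx γu)
    (s0 μ e : ℝ) (hsδ : s0 ≤ δc) (hsE : s0 ≤ Eh) (hμx : γx s0 ≤ μ) (hμu : γu s0 ≤ μ)
    (hμ : ∀ z ∈ Z, ‖(z.1 - xs, z.2 - us)‖ ≤ μ → ℓ z.1 z.2 ≤ ℓ xs us + e)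
    (N₁ : ℕ) (x₁ : Vec n) (H₁ : ℕ → Vec p) (u₁ : ℕ → Vec m)
    (hN₁ : d + T ≤ N₁) (hx₁ : x₁ ∈ Prod.fst '' Z) (hH₁ : H₁ ∈ HSet h Z T)
    (hu₁ : Admissible f h Z T N₁ x₁ H₁ u₁)
    (hend : ‖traj f x₁ u₁ d - xs‖ + measH T (fun k => storedH f h x₁ u₁ d k - h xs us) ≤ s0)
    (x₂ : Vec n) (H₂ : ℕ → Vec p)
    (hstart : ‖x₂ - xs‖ + measH T (fun k => H₂ k - h xs us) ≤ s0) :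
    ∃ w : ℕ → Vec m, Admissible f h Z T N₁ x₂ H₂ w ∧
      ∀ j, cost f ℓ x₂ w (d + j) ≤
        d * (ℓ xs us + e) + (cost f ℓ x₁ u₁ (d + j) - cost f ℓ x₁ u₁ d) := by
  have hst : ∀ k, storedH f h xs (fun _ => us) d k = h xs us := by
    intro k; simp [storedH, traj_const f xs us hfix]
  have m1 := measH_nonneg T (fun k => storedH f h x₁ u₁ d k - h xs us)
  have m2 := measH_nonneg T (fun k => H₂ k - h xs us)
  have n1 := norm_nonneg (traj f x₁ u₁ d - xs)
  have n2 := norm_nonneg (x₂ - xs)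
  have hmc : measH T (fun _ => h xs us) ≤ Eh := by
    refine measH_le _ _ _ hEh.le fun k _ => ?_
    have : hatCol (fun _ => h xs us) k = 0 := by
      simp [hatCol, hhs]
    rw [this]; exact hEh.le
  have L := hloc xs (fun _ => h xs us) (fun _ => us)
    (adm_const f h Z T (d + T) xs us hzs hfix hhs) hmc
    (fun k _ => by rw [traj_const f xs us hfix]; simpa using hδc.le)
    N₁ x₁ H₁ u₁ hN₁ hx₁ hH₁ hu₁ (by simp only [hst]; linarith) (by linarith)
    x₂ H₂ (by linarith) (by linarith)
  obtain ⟨u₂, -, hd, hadm, hclose⟩ := L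
  simp only [hst, traj_const f xs us hfix] at hclose
  set ζ := max (‖x₂ - xs‖ + measH T (fun j => H₂ j - h xs us))
    (‖traj f x₁ u₁ d - xs‖ + measH T (fun j => storedH f h x₁ u₁ d j - h xs us)) with hζ
  have hζ0 : 0 ≤ ζ := le_max_of_le_left (by linarith)
  have hζs : ζ ≤ s0 := max_le hstart hend
  refine ⟨_, hadm, fun j => ?_⟩
  set w : ℕ → Vec m := fun k => if k < d then u₂ k else u₁ k with hw
  have hwt : ∀ k ≤ d, traj f x₂ w k = traj f x₂ u₂ k := fun k hk =>
    traj_congr f x₂ _ _ k fun i hi => by simp [hw, show i < d by omega]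
  rw [cost_add, cost_add, hwt d le_rfl, hd]
  have hsh : (fun k => w (d + k)) = fun k => u₁ (d + k) := by
    funext k; simp [hw]
  rw [hsh]
  have : cost f ℓ x₂ w d ≤ d * (ℓ xs us + e) := by
    unfold cost
    calc _ ≤ ∑ k ∈ Finset.range d, (ℓ xs us + e) := by
          refine Finset.sum_le_sum fun k hk => ?_
          rw [Finset.mem_range] at hk
          refine hμ _ (hadm.1 k (by omega)) ?_
          obtain ⟨c1, c2⟩ := hclose k hk.le
          have hwk : w k = u₂ k := by simp [hw, hk]
          rw [Prod.norm_def]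
          refine max_le ?_ ?_
          · show ‖traj f x₂ w k - xs‖ ≤ μ
            rw [hwt k hk.le]
            exact c1.trans ((hγx.2.1.monotoneOn hζ0 (hζ0.trans hζs) hζs).trans hμx)
          · show ‖w k - us‖ ≤ μ
            rw [hwk]
            exact c2.trans ((hγu.2.1.monotoneOn hζ0 (hζ0.trans hζs) hζs).trans hμu)
      _ = _ := by simp [mul_add]
  linarith

theorem KInf.small {α : ℝ → ℝ} (hα : KInf α) (e : ℝ) (he : 0 < e) :
    ∃ s0 > 0, ∀ s, 0 ≤ s → s ≤ s0 → α s ≤ e := by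
  obtain ⟨hc, -, h0, -⟩ := hα
  have := Metric.continuousWithinAt_iff.mp (hc 0 (Set.mem_Ici.mpr le_rfl)) e he
  obtain ⟨δ, hδ, H⟩ := this
  refine ⟨δ / 2, by linarith, fun s hs hs' => ?_⟩
  have := H (Set.mem_Ici.mpr hs) (by rw [Real.dist_eq, sub_zero, abs_of_nonneg hs]; linarith)
  rw [h0, Real.dist_eq, sub_zero] at this
  exact (le_abs_self _).trans this.le

theorem KInf.nonneg {α : ℝ → ℝ} (hα : KInf α) (s : ℝ) (hs : 0 ≤ s) : 0 ≤ α s := by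
  have := hα.2.1.monotoneOn (Set.mem_Ici.mpr le_rfl) (Set.mem_Ici.mpr hs) hs
  rwa [hα.2.2.1] at this

theorem KInf.pos {α : ℝ → ℝ} (hα : KInf α) (s : ℝ) (hs : 0 < s) : 0 < α s := by
  have := hα.2.1 (Set.mem_Ici.mpr le_rfl) (Set.mem_Ici.mpr hs.le) hs
  rwa [hα.2.2.1] at this

theorem block_count (a : ℕ → ℝ) (ha : ∀ k, 0 ≤ a k) (T q0 M : ℕ) (c : ℝ)
    (hb : ∀ i < M, ∃ k, T * (q0 + i) ≤ k ∧ k < T * (q0 + i) + T ∧ c < a k) :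
    M * c ≤ ∑ k ∈ Finset.range (T * (q0 + M)), a k := by
  induction M with
  | zero => simpa using Finset.sum_nonneg fun k _ => ha k
  | succ M ih =>
    have ih := ih fun i hi => hb i (by omega)
    obtain ⟨k, hk1, hk2, hk3⟩ := hb M (by omega)
    have e : T * (q0 + (M + 1)) = T * (q0 + M) + T := by ring
    rw [e, Finset.sum_range_add]
    obtain ⟨j, rfl⟩ := Nat.exists_eq_add_of_le hk1
    have := Finset.single_le_sum (f := fun j => a (T * (q0 + M) + j)) (fun i _ => ha _)
      (Finset.mem_range.mpr (show j < T by omega))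
    push_cast
    linarith

/-- Sums of the auxiliary output over whole blocks are nonpositive. -/
theorem block_sum (f : Vec n → Vec m → Vec n) (h : Vec n → Vec m → Vec p)
    (Z : Set (Vec n × Vec m)) (T N : ℕ) (x : Vec n) (H : ℕ → Vec p) (u : ℕ → Vec m)
    (hu : Admissible f h Z T N x H u) (i : Fin p) (q : ℕ) (hq : T * q ≤ N) :
    ∑ k ∈ Finset.range (T * q), h (traj f x u k) (u k) i ≤ 0 := by
  induction q with
  | zero => simp
  | succ q ih =>
    have e : T * (q + 1) = T * q + T := by ring
    have ih := ih (by rw [e] at hq; omega)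
    have := hu.2.2 (T * q) (by omega) i
    rw [e, ← Finset.sum_range_add_sum_Ico _ (show T * q ≤ T * q + T by omega)]
    linarith

theorem rot_sum (f : Vec n → Vec m → Vec n) (ℓ : Vec n → Vec m → ℝ)
    (h : Vec n → Vec m → Vec p) (Z : Set (Vec n × Vec m)) (T N : ℕ)
    (xs : Vec n) (us : Vec m) (lam : Vec n → ℝ) (lb : Vec p) (ρ : ℝ → ℝ)
    (hlb : ∀ i, 0 ≤ lb i)
    (hdiss : ∀ z ∈ Z, lam (f z.1 z.2) - lam z.1 ≤
      ℓ z.1 z.2 - ℓ xs us + (∑ i, lb i * h z.1 z.2 i) - ρ ‖(z.1 - xs, z.2 - us)‖)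
    (x : Vec n) (H : ℕ → Vec p) (u : ℕ → Vec m)
    (hu : Admissible f h Z T N x H u) (q : ℕ) (hq : T * q ≤ N) :
    ∑ k ∈ Finset.range (T * q), ρ ‖(traj f x u k - xs, u k - us)‖ ≤
      cost f ℓ x u (T * q) - ((T * q : ℕ) : ℝ) * ℓ xs us + lam x - lam (traj f x u (T * q)) := by
  have h1 : ∀ Q ≤ N, ∑ k ∈ Finset.range Q, ρ ‖(traj f x u k - xs, u k - us)‖ ≤
      cost f ℓ x u Q - (Q : ℝ) * ℓ xs us + lam x - lam (traj f x u Q) +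
        ∑ k ∈ Finset.range Q, ∑ i, lb i * h (traj f x u k) (u k) i := by
    intro Q
    induction Q with
    | zero => intro _; simp [cost, traj]
    | succ Q ih =>
      intro hQ
      have ih := ih (by omega)
      have := hdiss _ (hu.1 Q (by omega))
      simp only at this
      simp only [cost, Finset.sum_range_succ, traj] at ih ⊢
      push_cast
      linarith
  have h2 := h1 _ hq
  have h3 : ∑ k ∈ Finset.range (T * q), ∑ i, lb i * h (traj f x u k) (u k) i ≤ 0 := by
    rw [Finset.sum_comm]
    refine Finset.sum_nonpos fun i _ => ?_
    rw [← Finset.mul_sum]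
    exact mul_nonpos_of_nonneg_of_nonpos (hlb i) (block_sum f h Z T N x H u hu i q hq)
  linarith
theorem coord_le (a b : Vec p) (i : Fin p) : |a i - b i| ≤ ‖a - b‖ := by
  have h1 := PiLp.norm_apply_le (a - b) i
  rwa [PiLp.sub_apply, Real.norm_eq_abs] at h1

set_option maxHeartbeats 1000000

theorem turnpike_near_steady_state (n m p T : ℕ) (hT : 1 ≤ T)
    (f : Vec n → Vec m → Vec n) (ℓ : Vec n → Vec m → ℝ)
    (h : Vec n → Vec m → Vec p) (Z : Set (Vec n × Vec m)) (Lh : ℝ)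
    (xs : Vec n) (us : Vec m) (lam : Vec n → ℝ) (lb : Vec p) (ρ : ℝ → ℝ)
    (δc Eh : ℝ) (d : ℕ) (γx γu : ℝ → ℝ)
    (ustar : ℕ → Vec n → (ℕ → Vec p) → ℕ → Vec m)
    -- Assumption 1 (compactness and continuity)
    (hZ : IsCompact Z)
    (hfc : ∃ αf : ℝ → ℝ, KInf αf ∧ ∀ z₁ ∈ Z, ∀ z₂ ∈ Z,
      ‖f z₁.1 z₁.2 - f z₂.1 z₂.2‖ ≤ αf ‖(z₁.1 - z₂.1, z₁.2 - z₂.2)‖)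
    (halc : ∃ αl : ℝ → ℝ, KInf αl ∧ ∀ z₁ ∈ Z, ∀ z₂ ∈ Z,
      |ℓ z₁.1 z₁.2 - ℓ z₂.1 z₂.2| ≤ αl ‖(z₁.1 - z₂.1, z₁.2 - z₂.2)‖)
    (hLh : 0 < Lh)
    (hhL : ∀ z₁ ∈ Z, ∀ z₂ ∈ Z,
      ‖h z₁.1 z₁.2 - h z₂.1 z₂.2‖ ≤ Lh * ‖(z₁.1 - z₂.1, z₁.2 - z₂.2)‖)
    -- optimal steady-state
    (hzs : (xs, us) ∈ Z) (hfix : f xs us = xs) (hhs : ∀ i, h xs us i ≤ 0)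
    -- Assumption 2 (strict dissipativity)
    (hρ : KInf ρ) (hlb : ∀ i, 0 ≤ lb i) (hlam0 : lam xs = 0)
    (hlamc : ∃ αlam : ℝ → ℝ, KInf αlam ∧ ∀ x₁ ∈ Prod.fst '' Z, ∀ x₂ ∈ Prod.fst '' Z,
      |lam x₁ - lam x₂| ≤ αlam ‖x₁ - x₂‖)
    (hdiss : ∀ z ∈ Z, lam (f z.1 z.2) - lam z.1 ≤
      ℓ z.1 z.2 - ℓ xs us + (∑ i, lb i * h z.1 z.2 i) - ρ ‖(z.1 - xs, z.2 - us)‖)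
    -- Assumption 3 (asymptotic controllability)
    (hac : ∃ β₁ β₂ : ℝ → ℕ → ℝ, KLS β₁ ∧ KLS β₂ ∧
      ∀ x ∈ Prod.fst '' Z, ∀ H ∈ HSet h Z T, ∀ N : ℕ, ∃ u : ℕ → Vec m,
        Admissible f h Z T N x H u ∧ ∀ k < N,
          ℓ (traj f x u k) (u k) - ℓ xs us ≤
            β₁ ‖x - xs‖ k + β₂ (measH T (fun j => H j - h xs us)) k ∧
          rot f ℓ h (ℓ xs us) lam lb (traj f x u k) (u k) ≤
            β₁ ‖x - xs‖ k + β₂ (measH T (fun j => H j - h xs us)) k)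
    -- Assumption 4 (local controllability)
    (hδc : 0 < δc) (hEh : 0 < Eh) (hdT : T ≤ d) (hγx : KInf γx) (hγu : KInf γu)
    (hloc : LocCtrl f h Z T xs δc Eh d γx γu)
    -- the value function is attained by the unique minimizer `ustar`
    (hopt : ∀ (N : ℕ), ∀ x ∈ Prod.fst '' Z, ∀ H ∈ HSet h Z T,
      Admissible f h Z T N x H (ustar N x H) ∧
      cost f ℓ x (ustar N x H) N = Jstar f ℓ h Z T N x H ∧
      ∀ u : ℕ → Vec m, Admissible f h Z T N x H u →
        cost f ℓ x u N = Jstar f ℓ h Z T N x H → ∀ k < N, u k = ustar N x H k)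
    :
    ∃ (Nη : ℕ) (η : ℕ → ℝ → ℝ),
      (∀ N r, 0 ≤ r → 0 ≤ η N r) ∧
      (∀ ε : ℝ, 0 < ε → ∃ (N₀ : ℕ) (r₀ : ℝ), 0 < r₀ ∧
        ∀ N, N₀ ≤ N → ∀ r : ℝ, 0 ≤ r → r ≤ r₀ → η N r ≤ ε) ∧
      ∀ (x : Vec n) (H : ℕ → Vec p), ‖x - xs‖ ≤ δc → x ∈ Prod.fst '' Z →
        H ∈ HSet h Z T → measH T (fun j => H j - h xs us) ≤ Eh →
        ∀ N : ℕ, Nη ≤ N → ∀ k : ℕ, (k : ℝ) ≤ (N : ℝ) / 2 + T - 1 →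
          ‖(traj f x (ustar N x H) k - xs, ustar N x H k - us)‖ ≤
            η N (‖x - xs‖ + measH T (fun j => H j - h xs us)) := by
  obtain ⟨αl, hαl, hαlZ⟩ := halc
  obtain ⟨αlam, hαlam, hαlamZ⟩ := hlamc
  have hxsX : xs ∈ Prod.fst '' Z := ⟨_, hzs, rfl⟩
  -- a bound for the size of `Z`
  obtain ⟨D, hD0, hD⟩ : ∃ D : ℝ, 0 ≤ D ∧ ∀ z ∈ Z, ‖(z.1 - xs, z.2 - us)‖ ≤ D := by
    obtain ⟨R, hR⟩ := hZ.isBounded.exists_norm_le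
    refine ⟨R + R, ?_, fun z hz => ?_⟩
    · have := (norm_nonneg _).trans (hR _ hzs); linarith
    · have e : (z.1 - xs, z.2 - us) = z - (xs, us) := rfl
      rw [e]
      exact (norm_sub_le _ _).trans (add_le_add (hR _ hz) (hR _ hzs))
  have hl : ∀ z ∈ Z, |ℓ z.1 z.2 - ℓ xs us| ≤ αl D := fun z hz =>
    (hαlZ z hz _ hzs).trans
      (hαl.2.1.monotoneOn (Set.mem_Ici.mpr (norm_nonneg _)) (Set.mem_Ici.mpr hD0) (hD z hz))
  have hla : ∀ y ∈ Prod.fst '' Z, |lam y| ≤ αlam ‖y - xs‖ := fun y hy => by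
    have := hαlamZ y hy xs hxsX
    rwa [hlam0, sub_zero] at this
  have hlaD : ∀ y ∈ Prod.fst '' Z, |lam y| ≤ αlam D := fun y hy => by
    refine (hla y hy).trans ?_
    obtain ⟨z, hz, rfl⟩ := hy
    refine hαlam.2.1.monotoneOn (Set.mem_Ici.mpr (norm_nonneg _)) (Set.mem_Ici.mpr hD0) ?_
    exact (norm_fst_le (z.1 - xs, z.2 - us)).trans (hD z hz)
  have hcoord : ∀ z ∈ Z, ∀ i, |h z.1 z.2 i - h xs us i| ≤
      Lh * ‖(z.1 - xs, z.2 - us)‖ := fun z hz i => by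
    exact (coord_le _ _ i).trans (hhL z hz (xs, us) hzs)
  have hset : ∀ g : ℕ → Vec p, (∀ k ∈ Finset.Icc 1 (T - 1), ∃ z ∈ Z, g k = h z.1 z.2) →
      g ∈ HSet h Z T := by
    intro g hg k hk i
    obtain ⟨z, hz, hgz⟩ := hg k hk
    rw [hgz]
    have hb : ∀ z ∈ Z, |h z.1 z.2 i - h xs us i| ≤ Lh * D := fun z hz =>
      (hcoord z hz i).trans (mul_le_mul_of_nonneg_left (hD z hz) hLh.le)
    constructor
    · refine csInf_le ⟨h xs us i - Lh * D, ?_⟩ ⟨z, hz, rfl⟩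
      rintro _ ⟨y, hy, rfl⟩
      have := (abs_le.mp (hb y hy)).1
      simp only; linarith
    · refine le_csSup ⟨h xs us i + Lh * D, ?_⟩ ⟨z, hz, rfl⟩
      rintro _ ⟨y, hy, rfl⟩
      have := (abs_le.mp (hb y hy)).2
      simp only; linarith
  have hHs : (fun _ => h xs us) ∈ HSet h Z T := hset _ fun _ _ => ⟨_, hzs, rfl⟩
  -- optimality of `ustar`
  have hmin : ∀ (N : ℕ) (x : Vec n) (H : ℕ → Vec p), x ∈ Prod.fst '' Z → H ∈ HSet h Z T →
      ∀ w, Admissible f h Z T N x H w → cost f ℓ x (ustar N x H) N ≤ cost f ℓ x w N := by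
    intro N x H hx hH w hw
    rw [(hopt N x hx H hH).2.1]
    refine csInf_le ⟨∑ k ∈ Finset.range N, (ℓ xs us - αl D), ?_⟩ ⟨w, hw, rfl⟩
    rintro _ ⟨v, hv, rfl⟩
    refine Finset.sum_le_sum fun k hk => ?_
    have := (abs_le.mp (hl _ (hv.1 k (Finset.mem_range.mp hk)))).1
    simp only at this
    linarith
  have key : ∀ ε : ℝ, 0 < ε → ∃ (N₀ : ℕ) (s0 : ℝ), 0 < s0 ∧
      ∀ (x : Vec n) (H : ℕ → Vec p), x ∈ Prod.fst '' Z → H ∈ HSet h Z T →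
        ‖x - xs‖ + measH T (fun j => H j - h xs us) ≤ s0 →
        ∀ N : ℕ, N₀ ≤ N → ∀ k : ℕ, (k : ℝ) ≤ (N : ℝ) / 2 + T - 1 →
          ‖(traj f x (ustar N x H) k - xs, ustar N x H k - us)‖ ≤ ε := by
    intro ε hε
    have hρε := hρ.pos ε hε
    set e : ℝ := ρ ε / (2 * d + 2) with he
    have hden : (0 : ℝ) < 2 * d + 2 := by positivity
    have he0 : 0 < e := div_pos hρε hden
    have hee : e * (2 * d + 2) = ρ ε := div_mul_cancel₀ _ hden.ne'
    obtain ⟨μ, hμ0, hμ⟩ := hαl.small e he0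
    obtain ⟨s1, hs1, hγ1⟩ := hγx.small μ hμ0
    obtain ⟨s2, hs2, hγ2⟩ := hγu.small μ hμ0
    obtain ⟨s3, hs3, hγ3⟩ := hαlam.small e he0
    obtain ⟨s0, hs0, hs01, hs02, hs03, hs0δ, hs0E⟩ : ∃ s0 : ℝ, 0 < s0 ∧ s0 ≤ s1 ∧ s0 ≤ s2 ∧
        s0 ≤ s3 ∧ s0 ≤ δc ∧ s0 ≤ Eh := by
      refine ⟨min s1 (min s2 (min s3 (min δc Eh))), by positivity, ?_, ?_, ?_, ?_, ?_⟩ <;> simp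
    have hμℓ : ∀ z ∈ Z, ‖(z.1 - xs, z.2 - us)‖ ≤ μ → ℓ z.1 z.2 ≤ ℓ xs us + e := by
      intro z hz hzμ
      have h1 := (abs_le.mp (hαlZ z hz _ hzs)).2
      have h2 := hμ _ (norm_nonneg _) hzμ
      simp only at h1
      linarith
    have spl := splice T f ℓ h Z xs us δc Eh d γx γu hzs hfix hhs hδc hEh hγx hγu hloc
      s0 μ e hs0δ hs0E (hγ1 _ hs0.le hs01) (hγ2 _ hs0.le hs02) hμℓ
    set σ : ℝ := s0 / (1 + p * Lh) with hσ
    have hden2 : (0 : ℝ) < 1 + p * Lh := by positivity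
    have hσ0 : 0 < σ := div_pos hs0 hden2
    have hσe : σ * (1 + p * Lh) = s0 := div_mul_cancel₀ _ hden2.ne'
    have hσs : σ ≤ s0 := by
      have : 0 ≤ σ * (p * Lh) := by positivity
      linarith
    set C : ℝ := d * e + T * αl D + 2 * αlam D with hC
    obtain ⟨M, hM⟩ := exists_nat_gt (C / ρ σ)
    have hMC : C < M * ρ σ := (div_lt_iff₀ (hρ.pos σ hσ0)).mp hM
    refine ⟨2 * T * (M + 3) + 4 * d + 2 * T, s0, hs0, ?_⟩
    intro x H hx hH hr N hN k hk
    obtain ⟨hadm, -, -⟩ := hopt N x hx H hH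
    have hmn := hmin N x H hx hH
    set u := ustar N x H with hu
    have hr1 : ‖x - xs‖ ≤ s0 := by
      have := measH_nonneg T (fun j => H j - h xs us); linarith
    -- arithmetic of the blocks
    obtain ⟨q0, hq0a, hq0b⟩ : ∃ q0 : ℕ, N + 2 * T < 2 * (T * q0) ∧ 2 * (T * q0) ≤ N + 4 * T := by
      refine ⟨N / (2 * T) + 2, ?_, ?_⟩
      · have := Nat.lt_mul_div_succ N (show 0 < 2 * T by omega)
        nlinarith
      · have := Nat.mul_div_le N (2 * T)
        nlinarith
    have hqM : T * (q0 + M) + 1 ≤ N := by nlinarith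
    -- the rotated cost on the whole horizon is bounded
    have hbound : ∑ k ∈ Finset.range (T * (q0 + M)), ρ ‖(traj f x u k - xs, u k - us)‖ ≤ C := by
      obtain ⟨w, hw, hwc⟩ := spl N xs (fun _ => h xs us) (fun _ => us) (by nlinarith) hxsX hHs
        (adm_const f h Z T N xs us hzs hfix hhs)
        (by
          rw [traj_const f xs us hfix, measH_zero]
          · simpa using hs0.le
          · intro k _; simp [storedH, traj_const f xs us hfix]) x H hr
      have hcw := hmn w hw
      have hwN := hwc (N - d)
      rw [show d + (N - d) = N by omega, cost_const f ℓ xs us hfix, cost_const f ℓ xs us hfix]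
        at hwN
      -- go to the last block end before `N`
      obtain ⟨q1, hq1a, hq1b, hq1c⟩ : ∃ q1 : ℕ, q0 + M ≤ q1 ∧ T * q1 < N ∧ N ≤ T * q1 + T := by
        refine ⟨(N - 1) / T, ?_, ?_, ?_⟩
        · rw [Nat.le_div_iff_mul_le (by omega)]; nlinarith [Nat.sub_add_cancel (show 1 ≤ N by omega)]
        · have := Nat.mul_div_le (N - 1) T; omega
        · have := Nat.lt_mul_div_succ (N - 1) (show 0 < T by omega)
          rw [Nat.mul_add, mul_one] at this; omega
      have hrs := rot_sum f ℓ h Z T N xs us lam lb ρ hlb hdiss x H u hadm q1 hq1b.le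
      have hmono : ∑ k ∈ Finset.range (T * (q0 + M)), ρ ‖(traj f x u k - xs, u k - us)‖ ≤
          ∑ k ∈ Finset.range (T * q1), ρ ‖(traj f x u k - xs, u k - us)‖ := by
        refine Finset.sum_le_sum_of_subset_of_nonneg ?_ ?_
        · exact Finset.range_mono (Nat.mul_le_mul_left T hq1a)
        · intro j _ _; exact hρ.nonneg _ (norm_nonneg _)
      have hl1 := (abs_le.mp (hlaD x hx)).2
      have hl2 := (abs_le.mp (hlaD _ ⟨_, hadm.1 (T * q1) hq1b, rfl⟩)).1
      simp only at hl2
      have htail : cost f ℓ x u (T * q1) + ((N : ℝ) - (T * q1 : ℕ)) * (ℓ xs us) - T * αl D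
          ≤ cost f ℓ x u N := by
        have h1 : cost f ℓ x u N = cost f ℓ x u (T * q1) +
            ∑ k ∈ Finset.Ico (T * q1) N, ℓ (traj f x u k) (u k) := by
          unfold cost
          rw [Finset.sum_range_add_sum_Ico _ hq1b.le]
        have h2 : ∑ k ∈ Finset.Ico (T * q1) N, (ℓ xs us - αl D) ≤
            ∑ k ∈ Finset.Ico (T * q1) N, ℓ (traj f x u k) (u k) := by
          refine Finset.sum_le_sum fun j hj => ?_
          rw [Finset.mem_Ico] at hj
          have := (abs_le.mp (hl _ (hadm.1 j hj.2))).1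
          simp only at this
          linarith
        rw [Finset.sum_const, Nat.card_Ico, nsmul_eq_mul, Nat.cast_sub hq1b.le] at h2
        have h3 : (N : ℝ) - (T * q1 : ℕ) ≤ T := by
          have : (N : ℝ) ≤ ((T * q1 + T : ℕ) : ℝ) := by exact_mod_cast hq1c
          push_cast at this ⊢; linarith
        have h4 := mul_le_mul_of_nonneg_right h3 (hαl.nonneg D hD0)
        rw [h1]; linarith
      linarith
    -- a block in the second half on which the trajectory is close to the steady state
    obtain ⟨q, hqa, hqb, hqc⟩ : ∃ q : ℕ, q0 ≤ q ∧ q + 1 ≤ q0 + M ∧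
        ∀ j, T * q ≤ j → j < T * q + T → ‖(traj f x u j - xs, u j - us)‖ ≤ σ := by
      by_contra hcon
      have := block_count (fun j => ρ ‖(traj f x u j - xs, u j - us)‖)
        (fun j => hρ.nonneg _ (norm_nonneg _)) T q0 M (ρ σ) (by
          intro i hi
          by_contra hcon2
          refine hcon ⟨q0 + i, by omega, by omega, fun j hj1 hj2 => ?_⟩
          by_contra hlt
          refine hcon2 ⟨j, hj1, hj2, ?_⟩
          exact hρ.2.1 (Set.mem_Ici.mpr hσ0.le) (Set.mem_Ici.mpr (norm_nonneg _)) (not_le.mp hlt))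
      linarith
    have hTq : T * q0 ≤ T * q := Nat.mul_le_mul_left T hqa
    have hTq1 : T * q + T ≤ T * (q0 + M) := by
      have := Nat.mul_le_mul_left T hqb
      rwa [Nat.mul_add, mul_one] at this
    obtain ⟨P, hP⟩ : ∃ P, T * q = P + d := ⟨T * q - d, by nlinarith [Nat.sub_add_cancel (show d ≤ T * q by nlinarith)]⟩
    have hPd : d + T ≤ P := by nlinarith
    obtain ⟨N1, rfl⟩ : ∃ N1, N = P + N1 := ⟨N - P, by omega⟩
    have hN1 : d + T ≤ N1 := by omega
    -- the competitor
    obtain ⟨u3, hu3, hu3c⟩ := spl N1 (traj f x u P) (storedH f h x u (P - T + 1))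
      (fun k => u (P + k)) hN1 ⟨_, hadm.1 P (by omega), rfl⟩
      (hset _ fun j hj => by
        rw [Finset.mem_Icc] at hj
        exact ⟨_, hadm.1 (P - T + 1 + j - 1) (by omega), rfl⟩)
      (adm_shift f h Z T P N1 x H u (by omega) (by omega) hadm)
      (by
        rw [← traj_add, ← hP]
        have h1 : ‖traj f x u (T * q) - xs‖ ≤ σ :=
          (norm_fst_le (traj f x u (T * q) - xs, u (T * q) - us)).trans
            (hqc _ le_rfl (by omega))
        have h2 : measH T (fun k => storedH f h (traj f x u P) (fun k => u (P + k)) d k - h xs us)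
            ≤ p * Lh * σ := by
          refine measH_le _ _ _ (by positivity) fun j hj => ?_
          rw [Finset.mem_Icc] at hj
          unfold hatCol
          calc _ ≤ ∑ i : Fin p, Lh * σ := by
                refine Finset.sum_le_sum fun i _ => max_le ?_ (by positivity)
                simp only [storedH, ← traj_add]
                have h3 := hcoord _ (hadm.1 (P + (d + j - 1)) (by omega)) i
                have h4 := hqc (P + (d + j - 1)) (by omega) (by omega)
                have h5 := mul_le_mul_of_nonneg_left h4 hLh.le
                exact (le_abs_self _).trans (h3.trans h5)
            _ = _ := by simp [mul_assoc]
        linarith)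
      xs (fun _ => h xs us) (by
        rw [measH_zero]
        · simpa using hs0.le
        · intro k _; simp)
    have hv := adm_prep f h Z T P N1 xs us hzs hfix hhs u3 (by omega) hu3
    obtain ⟨w, hw, hwc⟩ := spl (P + N1) xs (fun _ => h xs us) (prep us P u3) (by omega) hxsX hHs hv
      (by
        rw [traj_prep_le f xs us hfix P u3 d (by omega), measH_zero]
        · simpa using hs0.le
        · intro j hj
          rw [Finset.mem_Icc] at hj
          simp only [storedH]
          rw [traj_prep_le f xs us hfix P u3 _ (by omega), prep_lt us P u3 _ (by omega), sub_self])
      x H hr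
    have c1 := hmn w hw
    have c2 := hwc (P + N1 - d)
    rw [show d + (P + N1 - d) = P + N1 by omega, cost_prep f ℓ xs us hfix,
      cost_prep_le f ℓ xs us hfix P u3 d (by omega)] at c2
    have c3 := hu3c (N1 - d)
    rw [show d + (N1 - d) = N1 by omega] at c3
    have c4 := cost_add f ℓ x u P N1
    have c5 := cost_add f ℓ x u P d
    have c6 : cost f ℓ x u (T * q) ≤ ((T * q : ℕ) : ℝ) * ℓ xs us + 2 * (d * e) := by
      rw [hP]; push_cast; linarith
    have hrs := rot_sum f ℓ h Z T (P + N1) xs us lam lb ρ hlb hdiss x H u hadm q (by omega)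
    have hl1 := (abs_le.mp (hla x hx)).2
    have hl2 := (abs_le.mp (hla _ ⟨_, hadm.1 (T * q) (by omega), rfl⟩)).1
    simp only at hl2
    have hl3 := hγ3 _ (norm_nonneg _) (hr1.trans hs03)
    have hl4 := hγ3 ‖traj f x u (T * q) - xs‖ (norm_nonneg _)
      (((norm_fst_le (traj f x u (T * q) - xs, u (T * q) - us)).trans
            (hqc _ le_rfl (by omega))).trans (hσs.trans hs03))
    have hkQ : k < T * q := by
      have h1 : (2 * k : ℝ) + 2 ≤ ((P + N1 : ℕ) : ℝ) + 2 * T := by linarith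
      have h2 : 2 * k + 2 ≤ P + N1 + 2 * T := by exact_mod_cast h1
      omega
    have hsingle := Finset.single_le_sum
      (f := fun j => ρ ‖(traj f x u j - xs, u j - us)‖)
      (fun j _ => hρ.nonneg _ (norm_nonneg _)) (Finset.mem_range.mpr hkQ)
    have hfin : ρ ‖(traj f x u k - xs, u k - us)‖ ≤ ρ ε := by
      rw [← hee]
      linarith
    exact (hρ.2.1.le_iff_le (Set.mem_Ici.mpr (norm_nonneg _)) (Set.mem_Ici.mpr hε.le)).mp hfin
  -- definition of `η` as a supremum
  refine ⟨2 * T, fun N r => sSup {y : ℝ | ∃ (x : Vec n) (H : ℕ → Vec p) (k : ℕ),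
    x ∈ Prod.fst '' Z ∧ H ∈ HSet h Z T ∧
    r = ‖x - xs‖ + measH T (fun j => H j - h xs us) ∧ 2 * T ≤ N ∧
    (k : ℝ) ≤ (N : ℝ) / 2 + T - 1 ∧
    y = ‖(traj f x (ustar N x H) k - xs, ustar N x H k - us)‖}, ?_, ?_, ?_⟩
  · intro N r _
    refine Real.sSup_nonneg ?_
    rintro _ ⟨x, H, k, -, -, -, -, -, rfl⟩
    exact norm_nonneg _
  · intro ε hε
    obtain ⟨N₀, s0, hs0, hk⟩ := key ε hε
    refine ⟨N₀, s0, hs0, fun N hN r _ hr => ?_⟩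
    refine Real.sSup_le ?_ hε.le
    rintro _ ⟨x, H, k, hx, hH, hre, -, hkk, rfl⟩
    exact hk x H hx hH (by linarith) N hN k hkk
  · intro x H _ hx hH _ N hN k hk
    refine le_csSup ⟨D, ?_⟩ ⟨x, H, k, hx, hH, rfl, hN, hk, rfl⟩
    rintro _ ⟨x', H', k', hx', hH', -, -, hkk, rfl⟩
    refine hD (_, _) ((hopt N x' hx' H' hH').1.1 k' ?_)
    have h1 : (2 * k' : ℝ) + 2 ≤ (N : ℝ) + 2 * T := by linarith
    have h2 : 2 * k' + 2 ≤ N + 2 * T := by exact_mod_cast h1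
    omega


end EMPC
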